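/- arXiv:2403.07421 — 3 statements merged into one kernel-verified Lean document; each statement's English description precedes it below -/
import Mathlib

section
/- Let X be a separable metrizable space. If the space AM(X) of bounded admissible metrics on X, endowed with the sup-metric, is completely metrizable, then X is σ-compact. -/
open Set Filter Topology UniformConvergence

/-- `d : X × X → ℝ` is a metric on `X`. -/
def IsMetricFun {X : Type*} (d : X × X → ℝ) : Prop :=
  (∀ x y : X, d (x, y) = 0 ↔ x = y) ∧ (∀ x y : X, d (x, y) = d (y, x)) ∧
    (∀ x y z : X, d (x, z) ≤ d (x, y) + d (y, z))

/-- `d` induces the topology of `X`, i.e. `d` is an admissible metric. -/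
def InducesTopology {X : Type*} [TopologicalSpace X] (d : X × X → ℝ) : Prop :=
  ∀ s : Set X, IsOpen s ↔ ∀ x ∈ s, ∃ ε > 0, ∀ y : X, d (x, y) < ε → y ∈ s

/-- `d` is a bounded real-valued function. -/
def BoundedFun {X : Type*} (d : X × X → ℝ) : Prop := ∃ C : ℝ, ∀ p : X × X, |d p| ≤ C

/-- `AM X`: the set of bounded admissible metrics on `X`, regarded as a subset of the space
`C(X²)` of bounded continuous real-valued functions on `X × X`, which carries the
sup-metric (every admissible metric is continuous on `X × X`, so bounded admissible
metrics are exactly the elements of `C(X²)` satisfying the two conditions below). -/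
def AM (X : Type*) [TopologicalSpace X] : Set (BoundedContinuousFunction (X × X) ℝ) :=
  {f | IsMetricFun (⇑f) ∧ InducesTopology (⇑f)}

/-- A topological space is completely metrizable if its topology is induced by some
complete metric. -/
def CompletelyMetrizable (Z : Type*) [t : TopologicalSpace Z] : Prop :=
  ∃ m : MetricSpace Z, m.toPseudoMetricSpace.toUniformSpace.toTopologicalSpace = t ∧
    @CompleteSpace Z m.toPseudoMetricSpace.toUniformSpace

/-- The range of an embedding of a completely metrizable space into a metrizable space is
a `Gδ` set. -/
theorem Topology.IsEmbedding.isGδ_range {Y Z : Type*} [TopologicalSpace Y]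
    [TopologicalSpace.IsCompletelyMetrizableSpace Y] [TopologicalSpace Z]
    [TopologicalSpace.MetrizableSpace Z] {f : Y → Z} (hf : IsEmbedding f) :
    IsGδ (range f) := by
  let _ := TopologicalSpace.metrizableSpaceMetric Z
  let _ := TopologicalSpace.upgradeIsCompletelyMetrizable Y
  let W : ℕ → Set Z := fun n ↦ ⋃₀ {U | IsOpen U ∧
    ∀ a b, f a ∈ U → f b ∈ U → dist a b < 1 / ((n : ℝ) + 1)}
  have hW : range f = closure (range f) ∩ ⋂ n, W n := by
    apply Subset.antisymm
    · rintro _ ⟨a, rfl⟩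
      refine ⟨subset_closure ⟨a, rfl⟩, mem_iInter.2 fun n ↦ ?_⟩
      have hn : 0 < 1 / ((n : ℝ) + 1) / 2 := by positivity
      obtain ⟨U, hU, hUa⟩ := hf.isOpen_iff.1
        (Metric.isOpen_ball (x := a) (ε := 1 / ((n : ℝ) + 1) / 2))
      refine ⟨U, ⟨hU, fun b c hb hc ↦ ?_⟩, ?_⟩
      · have hb' : b ∈ f ⁻¹' U := hb
        have hc' : c ∈ f ⁻¹' U := hc
        rw [hUa, Metric.mem_ball] at hb' hc'
        linarith [dist_triangle_right b c a]
      · change a ∈ f ⁻¹' U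
        rw [hUa]
        exact Metric.mem_ball_self hn
    · rintro z ⟨hz, hzW⟩
      have hne : (comap f (𝓝 z)).NeBot :=
        comap_neBot_iff_frequently.2 (mem_closure_iff_frequently.1 hz)
      have hc : Cauchy (comap f (𝓝 z)) := by
        refine Metric.cauchy_iff.2 ⟨hne, fun ε hε ↦ ?_⟩
        obtain ⟨n, hn⟩ := exists_nat_one_div_lt hε
        obtain ⟨U, ⟨hU, hUd⟩, hzU⟩ := mem_iInter.1 hzW n
        exact ⟨f ⁻¹' U, preimage_mem_comap (hU.mem_nhds hzU),
          fun a ha b hb ↦ (hUd a b ha hb).trans hn⟩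
      obtain ⟨a, ha⟩ := CompleteSpace.complete hc
      exact ⟨a, tendsto_nhds_unique ((hf.continuous.tendsto a).mono_left ha) tendsto_comap⟩
  rw [hW]
  exact isClosed_closure.isGδ.inter
    (IsGδ.iInter_of_isOpen fun n ↦ isOpen_sUnion fun U hU ↦ hU.1)

section Gluing

variable {H : Type*} [MetricSpace H]

/-- The pseudometric obtained from `dist` by gluing the points `z` and `w`. -/
def glueDist (z w x y : H) : ℝ :=
  min (dist x y) (min (dist x z + dist y w) (dist x w + dist y z))

theorem glueDist_le_dist (z w x y : H) : glueDist z w x y ≤ dist x y := min_le_left _ _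

theorem glueDist_nonneg (z w x y : H) : 0 ≤ glueDist z w x y := by
  unfold glueDist; positivity

theorem glueDist_comm (z w x y : H) : glueDist z w x y = glueDist z w y x := by
  simp only [glueDist, dist_comm x y, add_comm, min_comm]

theorem glueDist_triangle (z w x y u : H) :
    glueDist z w x u ≤ glueDist z w x y + glueDist z w y u := by
  have h1 : glueDist z w x u ≤ dist x u := min_le_left _ _
  have h2 : glueDist z w x u ≤ dist x z + dist u w := (min_le_right _ _).trans (min_le_left _ _)
  have h3 : glueDist z w x u ≤ dist x w + dist u z := (min_le_right _ _).trans (min_le_right _ _)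
  have t1 := dist_triangle x y u
  have t2 := dist_triangle x y z
  have t3 := dist_triangle x y w
  have t4 := dist_triangle u y z
  have t5 := dist_triangle u y w
  have t6 := dist_triangle_right x u z
  have t7 := dist_triangle_right x u w
  have s := dist_comm u y
  have p1 := dist_nonneg (x := y) (y := z)
  have p2 := dist_nonneg (x := y) (y := w)
  rcases min_choice (dist x y) (min (dist x z + dist y w) (dist x w + dist y z)) with a | a <;>
  rcases min_choice (dist x z + dist y w) (dist x w + dist y z) with b | b <;>
  rcases min_choice (dist y u) (min (dist y z + dist u w) (dist y w + dist u z)) with c | c <;>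
  rcases min_choice (dist y z + dist u w) (dist y w + dist u z) with d | d <;>
  (rw [glueDist.eq_def z w x y, glueDist.eq_def z w y u, a, c]; try rw [b]) <;>
  (try rw [d]) <;> linarith

theorem lt_dist_or_of_glueDist_lt {z w x y : H} {ε : ℝ} (h : glueDist z w x y < ε) :
    dist x y < ε ∨ dist x z < ε ∨ dist x w < ε := by
  rcases min_lt_iff.1 h with h | h
  · exact Or.inl h
  rcases min_lt_iff.1 h with h | h
  · exact Or.inr (Or.inl (by linarith [dist_nonneg (x := y) (y := w)]))
  · exact Or.inr (Or.inr (by linarith [dist_nonneg (x := y) (y := z)]))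

theorem abs_glueDist_sub_le (z z' w x y : H) :
    |glueDist z w x y - glueDist z' w x y| ≤ dist z z' := by
  refine (abs_min_sub_min_le_max _ _ _ _).trans (max_le (by simp) ?_)
  refine (abs_min_sub_min_le_max _ _ _ _).trans (max_le ?_ ?_)
  · simpa [dist_comm x] using abs_dist_sub_le z z' x
  · simpa [dist_comm y] using abs_dist_sub_le z z' y

theorem continuous_glueDist (z w : H) : Continuous fun p : H × H ↦ glueDist z w p.1 p.2 := by
  unfold glueDist; fun_prop

variable {X : Type*} [TopologicalSpace X] [CompactSpace H] {e : X → H}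

/-- The glued pseudometric on a compact space `H`, pulled back along `e : X → H` to a bounded
continuous function on `X × X`. -/
noncomputable def glueFun (he : Continuous e) (z w : H) : BoundedContinuousFunction (X × X) ℝ :=
  BoundedContinuousFunction.ofNormedAddCommGroup (fun p ↦ glueDist z w (e p.1) (e p.2))
    ((continuous_glueDist z w).comp (he.prodMap he)) (Metric.diam (univ : Set H)) fun p ↦ by
      rw [Real.norm_of_nonneg (glueDist_nonneg _ _ _ _)]
      exact (glueDist_le_dist _ _ _ _).trans
        (Metric.dist_le_diam_of_mem isCompact_univ.isBounded (mem_univ _) (mem_univ _))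

theorem glueFun_apply (he : Continuous e) (z w : H) (x y : X) :
    glueFun he z w (x, y) = glueDist z w (e x) (e y) := rfl

theorem continuous_glueFun (he : Continuous e) (w : H) : Continuous fun z ↦ glueFun he z w := by
  refine (LipschitzWith.of_dist_le_mul (K := 1) fun z z' ↦ ?_).continuous
  rw [NNReal.coe_one, one_mul]
  exact (BoundedContinuousFunction.dist_le dist_nonneg).2 fun p ↦ abs_glueDist_sub_le z z' w _ _

theorem glueFun_mem_AM (he : IsEmbedding e) {z w : H} (hz : z ∉ range e) (hw : w ∉ range e) :
    glueFun he.continuous z w ∈ AM X := by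
  have hz' (x : X) : 0 < dist (e x) z := dist_pos.2 fun h ↦ hz ⟨x, h⟩
  have hw' (x : X) : 0 < dist (e x) w := dist_pos.2 fun h ↦ hw ⟨x, h⟩
  refine ⟨⟨fun x y ↦ ⟨fun h ↦ ?_, ?_⟩, fun x y ↦ glueDist_comm _ _ _ _,
    fun x y u ↦ glueDist_triangle _ _ _ _ _⟩, fun s ↦ ⟨fun hs x hx ↦ ?_, fun hs ↦ ?_⟩⟩
  · refine he.injective (dist_le_zero.1 (not_lt.1 fun hxy ↦ ?_))
    have := lt_min hxy (lt_min (hz' x) (hw' x))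
    rw [glueFun_apply] at h
    rw [← h] at this
    rcases lt_dist_or_of_glueDist_lt this with h | h | h <;> simp at h
  · rintro rfl
    exact le_antisymm ((glueDist_le_dist _ _ _ _).trans_eq (dist_self _)) (glueDist_nonneg _ _ _ _)
  · obtain ⟨U, hU, rfl⟩ := he.isOpen_iff.1 hs
    obtain ⟨δ, hδ, hδU⟩ := Metric.isOpen_iff.1 hU (e x) hx
    refine ⟨min δ (min (dist (e x) z) (dist (e x) w)), lt_min hδ (lt_min (hz' x) (hw' x)),
      fun y hy ↦ hδU ?_⟩
    rcases lt_dist_or_of_glueDist_lt hy with h | h | h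
    · exact Metric.mem_ball'.2 (h.trans_le (min_le_left _ _))
    all_goals simp at h
  · refine isOpen_iff_mem_nhds.2 fun x hx ↦ ?_
    obtain ⟨ε, hε, hεs⟩ := hs x hx
    filter_upwards [he.continuous.continuousAt.preimage_mem_nhds (Metric.ball_mem_nhds (e x) hε)]
      with y hy
    exact hεs y ((glueDist_le_dist _ _ _ _).trans_lt (Metric.mem_ball'.1 hy))

theorem glueFun_notMem_AM (he : IsEmbedding e) (a : X) {w : H} (hw : w ∉ range e)
    (hwc : w ∈ closure (range e)) : glueFun he.continuous (e a) w ∉ AM X := by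
  intro h
  have hr : 0 < dist (e a) w := dist_pos.2 fun h ↦ hw ⟨a, h⟩
  obtain ⟨ε, hε, hεs⟩ := (h.2 (e ⁻¹' Metric.ball (e a) (dist (e a) w / 2))).1
    (Metric.isOpen_ball.preimage he.continuous) a (Metric.mem_ball_self (by linarith))
  obtain ⟨_, ⟨y, rfl⟩, hy⟩ := Metric.mem_closure_iff.1 hwc (min ε (dist (e a) w / 2))
    (lt_min hε (by linarith))
  have hglue : glueDist (e a) w (e a) (e y) ≤ dist w (e y) :=
    (min_le_right _ _).trans ((min_le_left _ _).trans_eq (by rw [dist_self, zero_add, dist_comm]))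
  have := Metric.mem_ball'.1 (hεs y (hglue.trans_lt (hy.trans_le (min_le_left _ _))))
  linarith [hy.trans_le (min_le_right _ _), dist_triangle_right (e a) w (e y)]

end Gluing

/-- A subset of a compact space with `Gδ` complement is `σ`-compact. -/
theorem IsGδ.isSigmaCompact_compl {H : Type*} [TopologicalSpace H] [CompactSpace H] {s : Set H}
    (hs : IsGδ s) : IsSigmaCompact sᶜ := by
  obtain ⟨U, hU, rfl⟩ := isGδ_iff_eq_iInter_nat.1 hs
  rw [compl_iInter]
  exact isSigmaCompact_iUnion_of_isCompact _ fun n ↦ (hU n).isClosed_compl.isCompact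

/-- If `X` is separable metrizable and `AM(X)` with the sup-metric is
completely metrizable, then `X` is σ-compact. -/
theorem sigmaCompact_of_completelyMetrizable_AM (X : Type*) [TopologicalSpace X]
    [TopologicalSpace.MetrizableSpace X] [TopologicalSpace.SeparableSpace X]
    (h : CompletelyMetrizable ↥(AM X)) :
    SigmaCompactSpace X := by
  let _ := TopologicalSpace.metrizableSpaceMetric X
  let _ := TopologicalSpace.metrizableSpaceMetric (ℕ → unitInterval)
  obtain ⟨e, he⟩ : ∃ e : X → ℕ → unitInterval, IsEmbedding e :=
    Metric.PiNatEmbed.exists_embedding_to_hilbert_cube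
  rw [← isSigmaCompact_univ_iff, he.isSigmaCompact_iff, image_univ]
  by_cases hcl : IsClosed (range e)
  · exact hcl.isCompact.isSigmaCompact
  obtain ⟨w, hwc, hw⟩ : ∃ w ∈ closure (range e), w ∉ range e := by
    by_contra! hsub
    exact hcl (isClosed_of_closure_subset hsub)
  have : TopologicalSpace.IsCompletelyMetrizableSpace (AM X) := ⟨h⟩
  have hG : IsGδ (AM X) := by simpa using (IsEmbedding.subtypeVal (p := (· ∈ AM X))).isGδ_range
  have hpre : (range e)ᶜ = (fun z ↦ glueFun he.continuous z w) ⁻¹' AM X := by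
    ext z
    refine ⟨fun hz ↦ glueFun_mem_AM he hz hw, ?_⟩
    rintro hz ⟨a, rfl⟩
    exact glueFun_notMem_AM he a hw hwc hz
  rw [← compl_compl (range e), hpre]
  exact (hG.preimage (continuous_glueFun he.continuous w)).isSigmaCompact_compl
end

section
/- Let X be a σ-compact metrizable space. Then AM(X), the set of bounded admissible metrics on X, is a Gδ subset of the space C(X²) of bounded continuous real-valued functions on X² equipped with the sup-metric. -/
open Set Filter Topology UniformConvergence

/-- The bounded continuous functions `f` such that `f`-small distances from points of `K` are
uniformly `ε`-small for the metric of `X`. -/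
def uniformlyDominating {X : Type*} [MetricSpace X] (K : Set X) (ε : ℝ) :
    Set (BoundedContinuousFunction (X × X) ℝ) :=
  {f | ∃ δ > 0, ∀ x ∈ K, ∀ y, f (x, y) < δ → dist x y < ε}

/-- The bounded continuous pseudometrics on `X`. -/
def boundedPseudometrics (X : Type*) [TopologicalSpace X] :
    Set (BoundedContinuousFunction (X × X) ℝ) :=
  {f | (∀ x, f (x, x) = 0) ∧ (∀ x y, f (x, y) = f (y, x)) ∧
    ∀ x y z, f (x, z) ≤ f (x, y) + f (y, z)}

theorem isClosed_boundedPseudometrics (X : Type*) [TopologicalSpace X] :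
    IsClosed (boundedPseudometrics X) := by
  have hc (p : X × X) : Continuous fun f : BoundedContinuousFunction (X × X) ℝ => f p :=
    continuous_eval_const p
  simp only [boundedPseudometrics, ofPred_and, ofPred_forall]
  refine (isClosed_iInter fun x => isClosed_eq (hc _) continuous_const).inter
    ((isClosed_iInter fun x => isClosed_iInter fun y => isClosed_eq (hc _) (hc _)).inter ?_)
  exact isClosed_iInter fun x => isClosed_iInter fun y => isClosed_iInter fun z =>
    isClosed_le (hc _) ((hc _).add (hc _))

theorem isOpen_uniformlyDominating {X : Type*} [MetricSpace X] (K : Set X) (ε : ℝ) :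
    IsOpen (uniformlyDominating K ε) := by
  refine Metric.isOpen_iff.2 fun f ⟨δ, hδ, hf⟩ => ⟨δ / 2, half_pos hδ, fun g hg => ?_⟩
  refine ⟨δ / 2, half_pos hδ, fun x hx y hxy => hf x hx y ?_⟩
  have h := (BoundedContinuousFunction.dist_coe_le_dist (f := g) (g := f) (x, y)).trans_lt hg
  rw [Real.dist_eq, abs_lt] at h
  linarith [h.1]

theorem AM_subset_uniformlyDominating {X : Type*} [MetricSpace X] {K : Set X}
    (hK : IsCompact K) {ε : ℝ} (hε : 0 < ε) : AM X ⊆ uniformlyDominating K ε := by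
  rintro f ⟨⟨hzero, -, htri⟩, htop⟩
  change ∃ δ > 0, ∀ x ∈ K, ∀ y, f (x, y) < δ → dist x y < ε
  refine hK.induction_on (p := fun s => ∃ δ > 0, ∀ x ∈ s, ∀ y, f (x, y) < δ → dist x y < ε)
    ⟨1, one_pos, fun _ h => h.elim⟩ ?_ ?_ ?_
  · rintro s t hst ⟨δ, hδ, h⟩
    exact ⟨δ, hδ, fun x hx => h x (hst hx)⟩
  · rintro s t ⟨δ, hδ, hs⟩ ⟨η, hη, ht⟩
    refine ⟨min δ η, lt_min hδ hη, ?_⟩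
    rintro x (hx | hx) y hxy
    · exact hs x hx y (hxy.trans_le (min_le_left _ _))
    · exact ht x hx y (hxy.trans_le (min_le_right _ _))
  · intro x _
    obtain ⟨η, hη, hx⟩ := (htop (Metric.ball x (ε / 2))).1 Metric.isOpen_ball x
      (Metric.mem_ball_self (half_pos hε))
    have hf : {z | f (x, z) < η / 2} ∈ 𝓝 x := by
      refine (isOpen_lt (by fun_prop) continuous_const).mem_nhds ?_
      simpa [(hzero x x).2 rfl] using hη
    refine ⟨_, mem_nhdsWithin_of_mem_nhds
      (inter_mem hf (Metric.ball_mem_nhds x (half_pos hε))), η / 2, half_pos hη, ?_⟩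
    rintro z ⟨hz, hzx⟩ y hzy
    have hy := hx y (by linarith [htri x z y, mem_ofPred_eq ▸ hz])
    rw [Metric.mem_ball] at hzx hy
    linarith [dist_triangle_right z y x]

theorem AM_eq_inter_uniformlyDominating {X : Type*} [MetricSpace X] [SigmaCompactSpace X] :
    AM X = boundedPseudometrics X ∩
      ⋂ (n : ℕ) (m : ℕ), uniformlyDominating (compactCovering X n) (1 / (m + 1 : ℝ)) := by
  refine Subset.antisymm (fun f hf => ⟨?_, ?_⟩) ?_
  · obtain ⟨⟨hzero, hsymm, htri⟩, -⟩ := hf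
    exact ⟨fun x => (hzero x x).2 rfl, hsymm, htri⟩
  · exact mem_iInter₂.2 fun n m =>
      AM_subset_uniformlyDominating (isCompact_compactCovering X n) Nat.one_div_pos_of_nat hf
  rintro f ⟨⟨hzero, hsymm, htri⟩, hdom⟩
  have key (x : X) (ε : ℝ) (hε : 0 < ε) : ∃ δ > 0, ∀ y, f (x, y) < δ → dist x y < ε := by
    obtain ⟨n, hn⟩ := exists_mem_compactCovering x
    obtain ⟨m, hm⟩ := exists_nat_one_div_lt hε
    obtain ⟨δ, hδ, h⟩ := mem_iInter₂.1 hdom n m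
    exact ⟨δ, hδ, fun y hy => (h x hn y hy).trans hm⟩
  refine ⟨⟨fun x y => ⟨fun h => ?_, ?_⟩, hsymm, htri⟩, fun s => ⟨fun hs x hx => ?_, fun h => ?_⟩⟩
  · refine eq_of_forall_dist_le fun ε hε => ?_
    obtain ⟨δ, hδ, hy⟩ := key x ε hε
    exact (hy y (h ▸ hδ)).le
  · rintro rfl
    exact hzero x
  · obtain ⟨ε, hε, hball⟩ := Metric.isOpen_iff.1 hs x hx
    obtain ⟨δ, hδ, hy⟩ := key x ε hε
    exact ⟨δ, hδ, fun y hxy => hball (Metric.mem_ball'.2 (hy y hxy))⟩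
  · refine isOpen_iff_mem_nhds.2 fun x hx => ?_
    obtain ⟨ε, hε, hy⟩ := h x hx
    have hx0 : x ∈ {y | f (x, y) < ε} := by simpa [hzero x] using hε
    exact mem_of_superset
      ((isOpen_lt (by fun_prop) continuous_const).mem_nhds hx0) hy

/-- If `X` is σ-compact metrizable, then `AM(X)` is a Gδ subset of the
space `C(X²)` of bounded continuous real-valued functions on `X²` with the sup-metric. -/
theorem isGdelta_AM_of_sigmaCompact (X : Type*) [TopologicalSpace X]
    [TopologicalSpace.MetrizableSpace X] [SigmaCompactSpace X] :
    IsGδ (AM X) := by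
  let : MetricSpace X := TopologicalSpace.metrizableSpaceMetric X
  rw [AM_eq_inter_uniformlyDominating]
  exact (isClosed_boundedPseudometrics X).isGδ.inter <| .iInter fun n => .iInter fun m =>
    (isOpen_uniformlyDominating _ _).isGδ
end

section
/- Let P = [0,1] ∩ ℙ and let X be the topological sum P ⊕ (0,1]. Then AM(X), endowed with the sup-metric, contains a closed subset that is isometric to the space Q = [0,1] ∩ ℚ of rationals in [0,1] with the Euclidean metric. -/
open Set Filter Topology UniformConvergence

/-- `P = [0,1] ∩ ℙ`, the irrationals in the unit interval. -/
def Pset : Set ℝ := Set.Icc 0 1 ∩ {x | Irrational x}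

/-- `Q = [0,1] ∩ ℚ`, the rationals in the unit interval. -/
def Qset : Set ℝ := Set.Icc 0 1 ∩ Set.range ((↑) : ℚ → ℝ)

/-- The topological sum `X = P ⊕ (0,1]`. -/
abbrev Xsum : Type := ↥Pset ⊕ ↥(Set.Ioc (0 : ℝ) 1)

/-- The metric `d_q` on `X = P ⊕ (0,1]` associated to `q`. -/
noncomputable def dq (q : ℝ) : Xsum × Xsum → ℝ
  | (Sum.inl x, Sum.inl y) => |(x : ℝ) - (y : ℝ)|
  | (Sum.inr x, Sum.inr y) => |(x : ℝ) - (y : ℝ)|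
  | (Sum.inl x, Sum.inr y) => |(x : ℝ) - q| + (y : ℝ)
  | (Sum.inr x, Sum.inl y) => (x : ℝ) + |(y : ℝ) - q|

/-- First coordinate of the map `Xsum → ℝ²` whose pullback of the `ℓ¹` metric is `dq q`. -/
noncomputable def fstCoord (q : ℝ) : Xsum → ℝ := Sum.elim (fun x => (x : ℝ)) (fun _ => q)

/-- Second coordinate of the map `Xsum → ℝ²` whose pullback of the `ℓ¹` metric is `dq q`. -/
noncomputable def sndCoord : Xsum → ℝ := Sum.elim (fun _ => 0) (fun y => (y : ℝ))

theorem dq_eq_l1 (q : ℝ) (x y : Xsum) :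
    dq q (x, y) = |fstCoord q x - fstCoord q y| + |sndCoord x - sndCoord y| := by
  rcases x with x | x <;> rcases y with y | y
  · simp [dq, fstCoord, sndCoord]
  · simp [dq, fstCoord, sndCoord, abs_of_pos y.2.1]
  · simp only [dq, fstCoord, sndCoord, Sum.elim_inl, Sum.elim_inr, sub_zero, abs_of_pos x.2.1]
    rw [abs_sub_comm, add_comm]
  · simp [dq, fstCoord, sndCoord]

theorem continuous_fstCoord (q : ℝ) : Continuous (fstCoord q) :=
  continuous_subtype_val.sumElim continuous_const

theorem continuous_sndCoord : Continuous sndCoord :=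
  continuous_const.sumElim continuous_subtype_val

theorem continuous_dq (q : ℝ) : Continuous (dq q) := by
  have h : dq q = fun p => |fstCoord q p.1 - fstCoord q p.2| + |sndCoord p.1 - sndCoord p.2| :=
    funext fun p => dq_eq_l1 q p.1 p.2
  rw [h]
  have h₁ := continuous_fstCoord q
  have h₂ := continuous_sndCoord
  fun_prop

theorem abs_dq_le {q : ℝ} (hq : q ∈ Icc (0 : ℝ) 1) (p : Xsum × Xsum) : |dq q p| ≤ 2 := by
  have h₁ : ∀ x, fstCoord q x ∈ Icc (0 : ℝ) 1 := by
    rintro (x | x)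
    exacts [x.2.1, hq]
  have h₂ : ∀ x, sndCoord x ∈ Icc (0 : ℝ) 1 := by
    rintro (x | x)
    exacts [⟨le_rfl, zero_le_one⟩, ⟨x.2.1.le, x.2.2⟩]
  obtain ⟨x, y⟩ := p
  rw [dq_eq_l1, abs_of_nonneg (by positivity)]
  have := abs_sub_le_of_le_of_le (h₁ x).1 (h₁ x).2 (h₁ y).1 (h₁ y).2
  have := abs_sub_le_of_le_of_le (h₂ x).1 (h₂ x).2 (h₂ y).1 (h₂ y).2
  linarith

/-- The function `dq q` as a bounded continuous function. -/
noncomputable def dqBounded (q : Icc (0 : ℝ) 1) : BoundedContinuousFunction (Xsum × Xsum) ℝ :=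
  BoundedContinuousFunction.ofNormedAddCommGroup (dq q) (continuous_dq q) 2 (abs_dq_le q.2)

theorem coe_dqBounded (q : Icc (0 : ℝ) 1) : ⇑(dqBounded q) = dq q := rfl

theorem abs_dq_sub_dq_le (q r : ℝ) (p : Xsum × Xsum) : |dq q p - dq r p| ≤ |q - r| := by
  have key (x : ℝ) : |(|x - q| - |x - r|)| ≤ |q - r| := by
    refine (abs_abs_sub_abs_le_abs_sub _ _).trans_eq ?_
    rw [sub_sub_sub_cancel_left, abs_sub_comm]
  rcases p with ⟨x | x, y | y⟩
  · simp [dq]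
  · simpa [dq] using key x
  · simpa [dq] using key y
  · simp [dq]

theorem exists_Pset_near {q : ℝ} (hq : q ∈ Icc (0 : ℝ) 1) {ε : ℝ} (hε : 0 < ε) :
    ∃ x : Pset, |(x : ℝ) - q| < ε := by
  have hlt : max 0 (q - ε) < min 1 (q + ε) := by
    simp only [max_lt_iff, lt_min_iff]
    refine ⟨⟨one_pos, ?_⟩, ?_, ?_⟩ <;> linarith [hq.1, hq.2]
  obtain ⟨x, hx, hx₁, hx₂⟩ := exists_irrational_btwn hlt
  simp only [max_lt_iff, lt_min_iff] at hx₁ hx₂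
  exact ⟨⟨x, ⟨hx₁.1.le, hx₂.1.le⟩, hx⟩, abs_lt.2 ⟨by linarith, by linarith⟩⟩

theorem isometry_dqBounded : Isometry dqBounded := by
  refine Isometry.of_dist_eq fun q r => le_antisymm ?_ ?_
  · exact (BoundedContinuousFunction.dist_le dist_nonneg).2 (abs_dq_sub_dq_le q r)
  · refine le_of_forall_pos_le_add fun ε hε => ?_
    obtain ⟨x, hx⟩ := exists_Pset_near q.2 (half_pos hε)
    have h := BoundedContinuousFunction.dist_coe_le_dist (f := dqBounded q) (g := dqBounded r)
      (Sum.inl x, Sum.inr ⟨1, one_pos, le_rfl⟩)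
    simp only [coe_dqBounded, dq, Real.dist_eq, add_sub_add_right_eq_sub] at h
    have h₁ := neg_le_of_abs_le h
    have h₂ := abs_sub_le (q : ℝ) x r
    rw [abs_sub_comm (q : ℝ) x] at h₂
    rw [Subtype.dist_eq, Real.dist_eq]
    linarith

theorem isMetricFun_dq (q : ℝ) : IsMetricFun (dq q) := by
  refine ⟨fun x y => ⟨fun h => ?_, ?_⟩, fun x y => ?_, fun x y z => ?_⟩
  · rcases x with x | x <;> rcases y with y | y <;> simp only [dq] at h
    · exact congrArg Sum.inl (Subtype.ext (sub_eq_zero.1 (abs_eq_zero.1 h)))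
    · linarith [y.2.1, abs_nonneg ((x : ℝ) - q)]
    · linarith [x.2.1, abs_nonneg ((y : ℝ) - q)]
    · exact congrArg Sum.inr (Subtype.ext (sub_eq_zero.1 (abs_eq_zero.1 h)))
  · rintro rfl
    simp [dq_eq_l1]
  · simp only [dq_eq_l1]
    rw [abs_sub_comm, abs_sub_comm (sndCoord x)]
  · simp only [dq_eq_l1]
    linarith [abs_sub_le (fstCoord q x) (fstCoord q y) (fstCoord q z),
      abs_sub_le (sndCoord x) (sndCoord y) (sndCoord z)]

theorem inducesTopology_dq {q : ℝ} (hq : q ∉ Pset) : InducesTopology (dq q) := by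
  refine fun s => ⟨fun hs x hx => ?_, fun h => isOpen_iff_mem_nhds.2 fun x hx => ?_⟩
  · obtain ⟨hl, hr⟩ := isOpen_sum_iff.1 hs
    rcases x with x | x
    · obtain ⟨ε, hε, hball⟩ := Metric.isOpen_iff.1 hl x hx
      have hxq : 0 < |(x : ℝ) - q| := abs_pos.2 (sub_ne_zero.2 fun h => hq (h ▸ x.2))
      refine ⟨min ε |(x : ℝ) - q|, lt_min hε hxq, ?_⟩
      rintro (y | y) hy <;> simp only [dq, lt_min_iff] at hy
      · refine hball (Metric.mem_ball'.2 ?_)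
        exact hy.1
      · linarith [y.2.1]
    · obtain ⟨ε, hε, hball⟩ := Metric.isOpen_iff.1 hr x hx
      refine ⟨min ε x, lt_min hε x.2.1, ?_⟩
      rintro (y | y) hy <;> simp only [dq, lt_min_iff] at hy
      · linarith [abs_nonneg ((y : ℝ) - q)]
      · refine hball (Metric.mem_ball'.2 ?_)
        exact hy.1
  · obtain ⟨ε, hε, hball⟩ := h x hx
    have hopen : IsOpen {y | dq q (x, y) < ε} :=
      isOpen_lt ((continuous_dq q).comp (Continuous.prodMk_right x)) continuous_const
    refine mem_of_superset (hopen.mem_nhds ?_) hball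
    simpa [dq_eq_l1] using hε

theorem not_inducesTopology_dq {q : ℝ} (hq : q ∈ Pset) : ¬ InducesTopology (dq q) := by
  intro h
  obtain ⟨ε, hε, hball⟩ := (h (range Sum.inl)).1 isOpen_range_inl (Sum.inl ⟨q, hq⟩) ⟨_, rfl⟩
  have hpos : 0 < min 1 (ε / 2) := lt_min one_pos (half_pos hε)
  have hlt : min 1 (ε / 2) < ε := (min_le_right _ _).trans_lt (half_lt_self hε)
  have := hball (Sum.inr ⟨min 1 (ε / 2), hpos, min_le_left _ _⟩) (by simpa [dq] using hlt)
  simp at this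

theorem mem_Qset_iff {q : ℝ} : q ∈ Qset ↔ q ∈ Icc (0 : ℝ) 1 ∧ q ∉ Pset := by
  simp only [Qset, Pset, Irrational, mem_inter_iff, mem_ofPred_eq]
  tauto

theorem dqBounded_mem_AM_iff {q : Icc (0 : ℝ) 1} : dqBounded q ∈ AM Xsum ↔ (q : ℝ) ∈ Qset := by
  rw [mem_Qset_iff]
  exact ⟨fun h => ⟨q.2, fun hq => not_inducesTopology_dq hq h.2⟩,
    fun h => ⟨isMetricFun_dq q, inducesTopology_dq h.2⟩⟩

/-- For `X = P ⊕ (0,1]`, the space `AM(X)` with the sup-metric contains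
a closed subset isometric to `Q = [0,1] ∩ ℚ` with the Euclidean metric. -/
theorem AM_contains_closed_copy_of_Q :
    ∃ S : Set ↥(AM Xsum), IsClosed S ∧ Nonempty (↥Qset ≃ᵢ ↥S) := by
  let F : Qset → AM Xsum := fun q => ⟨dqBounded ⟨q, q.2.1⟩, dqBounded_mem_AM_iff.2 q.2⟩
  have hF : Isometry F := Isometry.of_dist_eq fun q r =>
    isometry_dqBounded.dist_eq ⟨q, q.2.1⟩ ⟨r, r.2.1⟩
  have hrange : range F = Subtype.val ⁻¹' range dqBounded := by
    ext f
    constructor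
    · rintro ⟨q, rfl⟩
      exact ⟨_, rfl⟩
    · rintro ⟨q, hq⟩
      exact ⟨⟨q, dqBounded_mem_AM_iff.1 (hq ▸ f.2)⟩, Subtype.ext hq⟩
  refine ⟨range F, ?_, ⟨hF.isometryEquivOnRange⟩⟩
  rw [hrange]
  exact (isCompact_range isometry_dqBounded.continuous).isClosed.preimage continuous_subtype_val
end
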